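/- arXiv:2411.05658 — 4 statements merged into one kernel-verified Lean document; each statement's English description precedes it below -/
import Mathlib

section
/- Let f_θ be an L-layer fully connected network with differentiable activation h. Let (x, y), (x', y') ∈ ℝ^d × ℝ^n be two training examples. If the gradient of the per-example loss with respect to the first-layer weight matrix W₁ at (x, y) equals the corresponding gradient at (x', y'), the gradient with respect to the first-layer bias b₁ at (x, y) equals the corresponding gradient at (x', y'), and this common first-layer bias gradient is nonzero, then x = x'. -/
open scoped BigOperators

/-- `softmax z i = exp (z i) / ∑ j, exp (z j)`. -/
noncomputable def softmax {n : ℕ} (z : Fin n → ℝ) : Fin n → ℝ :=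
  fun i => Real.exp (z i) / ∑ j, Real.exp (z j)

/-- Cross-entropy loss `ℓ(ŷ, y) = -∑ i, y i * log (ŷ i)`. -/
noncomputable def xent {n : ℕ} (yhat y : Fin n → ℝ) : ℝ :=
  -∑ i, y i * Real.log (yhat i)

/-- `tmulVec W x = Wᵀ x`, i.e. `(tmulVec W x) j = ∑ m, W m j * x m`. -/
def tmulVec {d n : ℕ} (W : Fin d → Fin n → ℝ) (x : Fin d → ℝ) : Fin n → ℝ :=
  fun j => ∑ m, W m j * x m

/-- Activations of a fully connected network: `activ 0 x = x` and
`activ (i+1) x = h (Wᵢᵀ (activ i x) + bᵢ)` coordinatewise. -/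
noncomputable def activ (h : ℝ → ℝ) (dims : ℕ → ℕ)
    (W : ∀ i : ℕ, Fin (dims i) → Fin (dims (i + 1)) → ℝ)
    (bias : ∀ i : ℕ, Fin (dims (i + 1)) → ℝ) :
    (i : ℕ) → (Fin (dims 0) → ℝ) → Fin (dims i) → ℝ
  | 0 => fun x => x
  | (i + 1) => fun x j => h (tmulVec (W i) (activ h dims W bias i x) j + bias i j)

/-- Pre-activation `z_{i+1} = Wᵢᵀ aᵢ + bᵢ` of layer `i` of a fully connected network. -/
noncomputable def preact (h : ℝ → ℝ) (dims : ℕ → ℕ)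
    (W : ∀ i : ℕ, Fin (dims i) → Fin (dims (i + 1)) → ℝ)
    (bias : ∀ i : ℕ, Fin (dims (i + 1)) → ℝ) (i : ℕ) (x : Fin (dims 0) → ℝ) :
    Fin (dims (i + 1)) → ℝ :=
  fun j => tmulVec (W i) (activ h dims W bias i x) j + bias i j

/-- Shifting the first-layer weights is the same as shifting the first-layer bias. -/
theorem activ_shift (h : ℝ → ℝ) (dims : ℕ → ℕ)
    (W : ∀ i : ℕ, Fin (dims i) → Fin (dims (i + 1)) → ℝ)
    (bias : ∀ i : ℕ, Fin (dims (i + 1)) → ℝ) (x : Fin (dims 0) → ℝ)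
    (V : Fin (dims 0) → Fin (dims 1) → ℝ) (β : Fin (dims 1) → ℝ)
    (hV : ∀ j, tmulVec V x j + bias 0 j = tmulVec (W 0) x j + β j) (i : ℕ) :
    activ h dims (Function.update W 0 V) bias i x
        = activ h dims W (Function.update bias 0 β) i x ∧
      preact h dims (Function.update W 0 V) bias i x
        = preact h dims W (Function.update bias 0 β) i x := by
  induction i with
  | zero =>
    refine ⟨rfl, ?_⟩
    funext j
    simp only [preact, activ, Function.update_self]
    exact hV j
  | succ k ih =>
    have ha : activ h dims (Function.update W 0 V) bias (k + 1) x
        = activ h dims W (Function.update bias 0 β) (k + 1) x := by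
      funext j
      exact congrArg h (congrFun ih.2 j)
    refine ⟨ha, ?_⟩
    funext j
    simp only [preact]
    rw [ha, Function.update_of_ne (Nat.succ_ne_zero k), Function.update_of_ne (Nat.succ_ne_zero k)]

theorem preact_differentiable (h : ℝ → ℝ) (hdiff : Differentiable ℝ h) (dims : ℕ → ℕ)
    (W : ∀ i : ℕ, Fin (dims i) → Fin (dims (i + 1)) → ℝ)
    (bias : ∀ i : ℕ, Fin (dims (i + 1)) → ℝ) (x : Fin (dims 0) → ℝ) (i : ℕ) :
    ∀ j, Differentiable ℝ (fun β : Fin (dims 1) → ℝ =>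
      preact h dims W (Function.update bias 0 β) i x j) := by
  induction i with
  | zero =>
    intro j
    simp only [preact, activ, Function.update_self]
    exact (differentiable_const _).add (differentiable_apply (𝕜 := ℝ) j)
  | succ k ih =>
    intro j
    have ha : ∀ m, Differentiable ℝ (fun β : Fin (dims 1) → ℝ =>
        activ h dims W (Function.update bias 0 β) (k + 1) x m) :=
      fun m => hdiff.comp (ih m)
    simp only [preact, tmulVec, Function.update_of_ne (Nat.succ_ne_zero k)]
    fun_prop

theorem loss_differentiable {n : ℕ} {E : Type*} [NormedAddCommGroup E] [NormedSpace ℝ E]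
    (z : E → Fin n → ℝ) (hz : ∀ j, Differentiable ℝ (fun e => z e j)) (y : Fin n → ℝ) :
    Differentiable ℝ (fun e => xent (softmax (z e)) y) := by
  simp only [xent, softmax]
  have hpos : ∀ (_ : Fin n) e, 0 < ∑ j, Real.exp (z e j) := fun i e =>
    Finset.sum_pos (fun j _ => Real.exp_pos _) ⟨i, Finset.mem_univ i⟩
  refine Differentiable.neg (Differentiable.fun_sum fun i _ => ?_)
  refine (differentiable_const _).mul (Differentiable.log ?_ ?_)
  · simp only [div_eq_mul_inv]
    refine (hz i).exp.mul (Differentiable.fun_inv ?_ (fun e => (hpos i e).ne'))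
    exact Differentiable.fun_sum fun j _ => (hz j).exp
  · intro e
    exact (div_pos (Real.exp_pos _) (hpos i e)).ne'

/-- The weight gradient in the direction `e_m ⊗ v` is `x m` times the bias gradient along `v`. -/
theorem weight_grad (L : ℕ) (dims : ℕ → ℕ) (h : ℝ → ℝ)
    (hdiff : Differentiable ℝ h)
    (W : ∀ i : ℕ, Fin (dims i) → Fin (dims (i + 1)) → ℝ)
    (bias : ∀ i : ℕ, Fin (dims (i + 1)) → ℝ)
    (x : Fin (dims 0) → ℝ) (y : Fin (dims (L + 1)) → ℝ) (m : Fin (dims 0))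
    (v : Fin (dims 1) → ℝ) :
    fderiv ℝ (fun V : Fin (dims 0) → Fin (dims 1) → ℝ =>
            xent (softmax (preact h dims (Function.update W 0 V) bias L x)) y) (W 0)
            (Pi.single m v)
      = x m * fderiv ℝ (fun β : Fin (dims 1) → ℝ =>
            xent (softmax (preact h dims W (Function.update bias 0 β) L x)) y) (bias 0) v := by
  set G : (Fin (dims 1) → ℝ) → ℝ := fun β =>
    xent (softmax (preact h dims W (Function.update bias 0 β) L x)) y with hG
  have hGd : Differentiable ℝ G :=
    loss_differentiable _ (preact_differentiable h hdiff dims W bias x L) y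
  let T : (Fin (dims 0) → Fin (dims 1) → ℝ) →ₗ[ℝ] (Fin (dims 1) → ℝ) :=
    { toFun := fun V => tmulVec V x
      map_add' := by
        intro A B; funext j; simp [tmulVec, add_mul, Finset.sum_add_distrib]
      map_smul' := by
        intro c A; funext j; simp [tmulVec, mul_assoc, Finset.mul_sum] }
  let S := LinearMap.toContinuousLinearMap T
  have hS : ∀ V, S V = tmulVec V x := fun V => rfl
  have hF : (fun V : Fin (dims 0) → Fin (dims 1) → ℝ =>
      xent (softmax (preact h dims (Function.update W 0 V) bias L x)) y)
      = fun V => G (S V + (bias 0 - S (W 0))) := by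
    funext V
    simp only [hG]
    rw [(activ_shift h dims W bias x V (S V + (bias 0 - S (W 0))) ?_ L).2]
    intro j
    simp only [hS, Pi.add_apply, Pi.sub_apply]
    ring
  have hA : HasFDerivAt (fun V => S V + (bias 0 - S (W 0))) S (W 0) :=
    S.hasFDerivAt.add_const _
  have hp : S (W 0) + (bias 0 - S (W 0)) = bias 0 := by abel
  have hG0 : HasFDerivAt G (fderiv ℝ G (bias 0)) (S (W 0) + (bias 0 - S (W 0))) := by
    rw [hp]; exact (hGd _).hasFDerivAt
  have hSv : S (Pi.single m v) = x m • v := by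
    rw [hS]
    funext j
    simp only [tmulVec, Pi.smul_apply, smul_eq_mul]
    rw [Finset.sum_eq_single m]
    · simp [mul_comm]
    · intro b _ hb; simp [Pi.single_eq_of_ne hb]
    · simp
  have hc := (hG0.comp (W 0) hA).fderiv
  rw [hF]
  have := congrArg (fun D => D (Pi.single m v)) hc
  simp only [ContinuousLinearMap.comp_apply, hSv, map_smul, smul_eq_mul] at this
  exact this

/-- For an `(L+1)`-layer fully connected network `f_θ(x) = softmax (z_{L+1})` with
differentiable activation `h`, if the Fréchet gradients of the per-example
cross-entropy loss with respect to the first-layer weights `W₁` and biases `b₁`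
coincide at `(x, y)` and `(x', y')`, and the common first-layer bias gradient is
nonzero, then `x = x'`. -/
theorem first_layer_grads_determine_input (L : ℕ) (dims : ℕ → ℕ) (h : ℝ → ℝ)
    (hdiff : Differentiable ℝ h)
    (W : ∀ i : ℕ, Fin (dims i) → Fin (dims (i + 1)) → ℝ)
    (bias : ∀ i : ℕ, Fin (dims (i + 1)) → ℝ)
    (x x' : Fin (dims 0) → ℝ) (y y' : Fin (dims (L + 1)) → ℝ)
    (hW : fderiv ℝ (fun V : Fin (dims 0) → Fin (dims 1) → ℝ =>
            xent (softmax (preact h dims (Function.update W 0 V) bias L x)) y) (W 0)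
        = fderiv ℝ (fun V : Fin (dims 0) → Fin (dims 1) → ℝ =>
            xent (softmax (preact h dims (Function.update W 0 V) bias L x')) y') (W 0))
    (hb : fderiv ℝ (fun β : Fin (dims 1) → ℝ =>
            xent (softmax (preact h dims W (Function.update bias 0 β) L x)) y) (bias 0)
        = fderiv ℝ (fun β : Fin (dims 1) → ℝ =>
            xent (softmax (preact h dims W (Function.update bias 0 β) L x')) y') (bias 0))
    (hbne : fderiv ℝ (fun β : Fin (dims 1) → ℝ =>
            xent (softmax (preact h dims W (Function.update bias 0 β) L x)) y) (bias 0) ≠ 0) :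
    x = x' := by
  obtain ⟨v, hv⟩ : ∃ v, fderiv ℝ (fun β : Fin (dims 1) → ℝ =>
      xent (softmax (preact h dims W (Function.update bias 0 β) L x)) y) (bias 0) v ≠ 0 := by
    by_contra hcon
    push Not at hcon
    exact hbne (ContinuousLinearMap.ext hcon)
  funext m
  have h1 := weight_grad L dims h hdiff W bias x y m v
  have h2 := weight_grad L dims h hdiff W bias x' y' m v
  rw [hW, h2, ← hb] at h1
  exact (mul_right_cancel₀ hv h1).symm
end

section
/- Let f_θ be an L-layer fully connected network with differentiable activation h. Let (x, y), (x', y') ∈ ℝ^d × ℝ^n be two training examples, and set v = ∑_{i=1}^n y_i and v' = ∑_{i=1}^n y'_i. Suppose the gradient of the per-example loss with respect to the last-layer weight matrix W_L at (x, y) equals the corresponding gradient at (x', y'), the gradient with respect to the last-layer bias b_L at (x, y) equals the corresponding gradient at (x', y'), and this common last-layer bias gradient is nonzero. Then f_θ(x) = f_θ(x') and y = (v − v')·f_θ(x) + y'. -/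
open scoped BigOperators

theorem activ_update_W (h : ℝ → ℝ) (dims : ℕ → ℕ)
    (W : ∀ i : ℕ, Fin (dims i) → Fin (dims (i + 1)) → ℝ)
    (bias : ∀ i : ℕ, Fin (dims (i + 1)) → ℝ) (L : ℕ) (V) (x : Fin (dims 0) → ℝ) :
    ∀ i, i ≤ L → activ h dims (Function.update W L V) bias i x = activ h dims W bias i x := by
  intro i
  induction i with
  | zero => intro _; rfl
  | succ k ih =>
    intro hk
    funext j
    simp only [activ]
    rw [ih (by omega), Function.update_of_ne (by omega)]

theorem activ_update_b (h : ℝ → ℝ) (dims : ℕ → ℕ)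
    (W : ∀ i : ℕ, Fin (dims i) → Fin (dims (i + 1)) → ℝ)
    (bias : ∀ i : ℕ, Fin (dims (i + 1)) → ℝ) (L : ℕ) (β) (x : Fin (dims 0) → ℝ) :
    ∀ i, i ≤ L → activ h dims W (Function.update bias L β) i x = activ h dims W bias i x := by
  intro i
  induction i with
  | zero => intro _; rfl
  | succ k ih =>
    intro hk
    funext j
    simp only [activ]
    rw [ih (by omega), Function.update_of_ne (by omega)]

/-- Derivative of the loss with respect to the logits. -/
noncomputable def lossD {n : ℕ} (z y : Fin n → ℝ) : (Fin n → ℝ) →L[ℝ] ℝ :=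
  ∑ i, ((∑ j, y j) * softmax z i - y i) • ContinuousLinearMap.proj (R := ℝ) (φ := fun _ => ℝ) i

theorem lossD_apply {n : ℕ} (z y w : Fin n → ℝ) :
    lossD z y w = ∑ i, ((∑ j, y j) * softmax z i - y i) * w i := by
  simp [lossD, ContinuousLinearMap.sum_apply]

theorem hasFDerivAt_loss {n : ℕ} (hn : 0 < n) (z y : Fin n → ℝ) :
    HasFDerivAt (fun z => xent (softmax z) y) (lossD z y) z := by
  haveI : Nonempty (Fin n) := ⟨⟨0, hn⟩⟩
  have hpos : ∀ z : Fin n → ℝ, 0 < ∑ j, Real.exp (z j) := fun z =>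
    Finset.sum_pos (fun i _ => Real.exp_pos _) Finset.univ_nonempty
  have hE : (fun z : Fin n → ℝ => xent (softmax z) y) =
      fun z => (∑ j, y j) * Real.log (∑ j, Real.exp (z j)) - ∑ i, y i * z i := by
    funext z
    simp only [xent, softmax]
    have : ∀ i, y i * Real.log (Real.exp (z i) / ∑ j, Real.exp (z j)) =
        y i * z i - y i * Real.log (∑ j, Real.exp (z j)) := by
      intro i
      rw [Real.log_div (Real.exp_pos _).ne' (hpos z).ne', Real.log_exp]; ring
    simp only [this, Finset.sum_sub_distrib, Finset.sum_mul]
    ring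
  rw [hE]
  have hp : ∀ i : Fin n, HasFDerivAt (fun z : Fin n → ℝ => z i)
      (ContinuousLinearMap.proj (R := ℝ) (φ := fun _ => ℝ) i) z := fun i => hasFDerivAt_apply i z
  have h1 := HasFDerivAt.fun_sum (u := Finset.univ) (fun i _ => (hp i).exp)
  have h2 := (h1.log (hpos z).ne').const_mul (∑ j, y j)
  have h3 := HasFDerivAt.fun_sum (u := Finset.univ) (fun i _ => (hp i).const_mul (y i))
  refine (h2.sub h3).congr_fderiv ?_
  ext w
  rw [lossD_apply]
  simp only [ContinuousLinearMap.sub_apply, ContinuousLinearMap.smul_apply,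
    ContinuousLinearMap.sum_apply, ContinuousLinearMap.proj_apply, smul_eq_mul, softmax,
    sub_mul, Finset.sum_sub_distrib, Finset.mul_sum]
  congr 1
  refine Finset.sum_congr rfl fun i _ => ?_
  ring

theorem fderiv_bias {n : ℕ} (hn : 0 < n) (c β y : Fin n → ℝ) :
    fderiv ℝ (fun β : Fin n → ℝ => xent (softmax (fun j => c j + β j)) y) β
      = lossD (fun j => c j + β j) y := by
  have h1 : HasFDerivAt (fun β : Fin n → ℝ => (fun j => c j + β j))
      (ContinuousLinearMap.id ℝ (Fin n → ℝ)) β := (hasFDerivAt_id β).const_add c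
  have h2 := (hasFDerivAt_loss hn (fun j => c j + β j) y).comp β h1
  exact h2.fderiv

/-- `V ↦ tmulVec V a` as a continuous linear map. -/
noncomputable def tmulCLM {d n : ℕ} (a : Fin d → ℝ) : (Fin d → Fin n → ℝ) →L[ℝ] (Fin n → ℝ) :=
  LinearMap.toContinuousLinearMap
    { toFun := fun V => tmulVec V a
      map_add' := by
        intro V V'; funext j; simp [tmulVec, add_mul, Finset.sum_add_distrib]
      map_smul' := by
        intro r V; funext j; simp [tmulVec, Finset.mul_sum, mul_assoc] }

theorem fderiv_weight {d n : ℕ} (hn : 0 < n) (a : Fin d → ℝ) (b y : Fin n → ℝ)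
    (V U : Fin d → Fin n → ℝ) :
    fderiv ℝ (fun V : Fin d → Fin n → ℝ => xent (softmax (fun j => tmulVec V a j + b j)) y) V U
      = lossD (fun j => tmulVec V a j + b j) y (tmulVec U a) := by
  have h1 : HasFDerivAt (fun V : Fin d → Fin n → ℝ => (fun j => tmulVec V a j + b j))
      (tmulCLM a) V := (tmulCLM a).hasFDerivAt.add_const b
  have h2 := (hasFDerivAt_loss hn (fun j => tmulVec V a j + b j) y).comp V h1
  have h3 := h2.fderiv
  exact congrArg (fun T => T U) h3

theorem lossD_single {n : ℕ} (z y : Fin n → ℝ) (i : Fin n) (t : ℝ) :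
    lossD z y (fun j => if j = i then t else 0) = ((∑ j, y j) * softmax z i - y i) * t := by
  rw [lossD_apply]; simp

/-- If the last-layer weight and bias gradients of the per-example loss coincide at
`(x, y)` and `(x', y')`, and the common last-layer bias gradient is nonzero, then
`f_θ(x) = f_θ(x')` and `y = (v - v') • f_θ(x) + y'` where `v = ∑ y`, `v' = ∑ y'`. -/
theorem last_layer_grads_relate_labels (L : ℕ) (dims : ℕ → ℕ) (h : ℝ → ℝ)
    (hdiff : Differentiable ℝ h)
    (W : ∀ i : ℕ, Fin (dims i) → Fin (dims (i + 1)) → ℝ)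
    (bias : ∀ i : ℕ, Fin (dims (i + 1)) → ℝ)
    (x x' : Fin (dims 0) → ℝ) (y y' : Fin (dims (L + 1)) → ℝ)
    (v v' : ℝ) (hv : v = ∑ i, y i) (hv' : v' = ∑ i, y' i)
    (hW : fderiv ℝ (fun V : Fin (dims L) → Fin (dims (L + 1)) → ℝ =>
            xent (softmax (preact h dims (Function.update W L V) bias L x)) y) (W L)
        = fderiv ℝ (fun V : Fin (dims L) → Fin (dims (L + 1)) → ℝ =>
            xent (softmax (preact h dims (Function.update W L V) bias L x')) y') (W L))
    (hb : fderiv ℝ (fun β : Fin (dims (L + 1)) → ℝ =>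
            xent (softmax (preact h dims W (Function.update bias L β) L x)) y) (bias L)
        = fderiv ℝ (fun β : Fin (dims (L + 1)) → ℝ =>
            xent (softmax (preact h dims W (Function.update bias L β) L x')) y') (bias L))
    (hbne : fderiv ℝ (fun β : Fin (dims (L + 1)) → ℝ =>
            xent (softmax (preact h dims W (Function.update bias L β) L x)) y) (bias L) ≠ 0) :
    softmax (preact h dims W bias L x) = softmax (preact h dims W bias L x') ∧
      y = fun i => (v - v') * softmax (preact h dims W bias L x) i + y' i := by
  have hn : 0 < dims (L + 1) := by
    rcases Nat.eq_zero_or_pos (dims (L + 1)) with h0 | h0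
    · exfalso
      apply hbne
      haveI : IsEmpty (Fin (dims (L + 1))) := by rw [h0]; infer_instance
      ext w
      rw [Subsingleton.elim w 0]
      simp
    · exact h0
  have eW : ∀ (V : Fin (dims L) → Fin (dims (L + 1)) → ℝ) (x : Fin (dims 0) → ℝ),
      preact h dims (Function.update W L V) bias L x
        = fun j => tmulVec V (activ h dims W bias L x) j + bias L j := by
    intro V x
    unfold preact
    rw [activ_update_W h dims W bias L V x L le_rfl, Function.update_self]
  have eb : ∀ (β : Fin (dims (L + 1)) → ℝ) (x : Fin (dims 0) → ℝ),
      preact h dims W (Function.update bias L β) L x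
        = fun j => tmulVec (W L) (activ h dims W bias L x) j + β j := by
    intro β x
    unfold preact
    rw [activ_update_b h dims W bias L β x L le_rfl, Function.update_self]
  have fW : ∀ (x : Fin (dims 0) → ℝ) (y : Fin (dims (L + 1)) → ℝ),
      (fun V : Fin (dims L) → Fin (dims (L + 1)) → ℝ =>
        xent (softmax (preact h dims (Function.update W L V) bias L x)) y)
      = fun V => xent (softmax (fun j => tmulVec V (activ h dims W bias L x) j + bias L j)) y :=
    fun x y => funext fun V => by rw [eW]
  have fb : ∀ (x : Fin (dims 0) → ℝ) (y : Fin (dims (L + 1)) → ℝ),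
      (fun β : Fin (dims (L + 1)) → ℝ =>
        xent (softmax (preact h dims W (Function.update bias L β) L x)) y)
      = fun β => xent (softmax (fun j => tmulVec (W L) (activ h dims W bias L x) j + β j)) y :=
    fun x y => funext fun β => by rw [eb]
  rw [fW, fW] at hW
  rw [fb, fb] at hb
  rw [fb] at hbne
  show softmax (fun j => tmulVec (W L) (activ h dims W bias L x) j + bias L j)
      = softmax (fun j => tmulVec (W L) (activ h dims W bias L x') j + bias L j) ∧
    y = fun i => (v - v') * softmax (fun j => tmulVec (W L) (activ h dims W bias L x) j + bias L j) i + y' i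
  rw [fderiv_bias hn, fderiv_bias hn] at hb
  rw [fderiv_bias hn] at hbne
  generalize activ h dims W bias L x = a at *
  generalize activ h dims W bias L x' = a' at *
  have hi : ∃ i, (∑ j, y j) * softmax (fun j => tmulVec (W L) a j + bias L j) i - y i ≠ 0 := by
    by_contra! hc
    apply hbne
    ext w
    rw [lossD_apply]
    simp [hc]
  obtain ⟨i, hi⟩ := hi
  have haa : a = a' := by
    funext m
    have hU := DFunLike.congr_fun hW (fun m' j => if j = i then (if m' = m then 1 else 0) else 0)
    rw [fderiv_weight hn, fderiv_weight hn, ← hb] at hU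
    have ht : ∀ a : Fin (dims L) → ℝ,
        tmulVec (fun m' (j : Fin (dims (L + 1))) => if j = i then (if m' = m then (1 : ℝ) else 0) else 0) a
          = fun j => if j = i then a m else 0 := by
      intro a
      funext j
      by_cases hj : j = i <;> simp [tmulVec, hj]
    rw [ht, ht, lossD_single, lossD_single] at hU
    exact mul_left_cancel₀ hi hU
  subst haa
  refine ⟨rfl, ?_⟩
  funext k
  have hk := DFunLike.congr_fun hb (fun j => if j = k then 1 else 0)
  rw [lossD_single, lossD_single, ← hv, ← hv'] at hk
  linarith
end

section
/- Let f_θ be an L-layer fully connected network with differentiable activation h. Let (x, y), (x', y') ∈ ℝ^d × ℝ^n be two training examples. Suppose the gradient of the per-example loss with respect to the last-layer weight matrix W_L at (x, y) equals the corresponding gradient at (x', y'), the gradient with respect to the last-layer bias b_L at (x, y) equals the corresponding gradient at (x', y'), this common last-layer bias gradient is nonzero, and ∑_{i=1}^n y_i = ∑_{i=1}^n y'_i. Then y = y'. -/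
open scoped BigOperators

theorem activ_congr_aux (h : ℝ → ℝ) (dims : ℕ → ℕ)
    (W W' : ∀ i : ℕ, Fin (dims i) → Fin (dims (i + 1)) → ℝ)
    (b b' : ∀ i : ℕ, Fin (dims (i + 1)) → ℝ) (x : Fin (dims 0) → ℝ) (i : ℕ)
    (hW : ∀ k < i, W k = W' k) (hb : ∀ k < i, b k = b' k) :
    activ h dims W b i x = activ h dims W' b' i x := by
  induction i with
  | zero => rfl
  | succ i ih =>
    have := ih (fun k hk => hW k (by omega)) (fun k hk => hb k (by omega))
    funext j
    simp only [activ]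
    rw [this, hW i (by omega), hb i (by omega)]

theorem preact_updW (h : ℝ → ℝ) (dims : ℕ → ℕ)
    (W : ∀ i : ℕ, Fin (dims i) → Fin (dims (i + 1)) → ℝ)
    (b : ∀ i : ℕ, Fin (dims (i + 1)) → ℝ) (L : ℕ) (x : Fin (dims 0) → ℝ)
    (V : Fin (dims L) → Fin (dims (L + 1)) → ℝ) :
    preact h dims (Function.update W L V) b L x
      = tmulVec V (activ h dims W b L x) + b L := by
  funext j
  simp only [preact, Function.update_self, Pi.add_apply]
  rw [activ_congr_aux h dims (Function.update W L V) W b b x L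
    (fun k hk => Function.update_of_ne (by omega) _ _) (fun _ _ => rfl)]

theorem preact_updb (h : ℝ → ℝ) (dims : ℕ → ℕ)
    (W : ∀ i : ℕ, Fin (dims i) → Fin (dims (i + 1)) → ℝ)
    (b : ∀ i : ℕ, Fin (dims (i + 1)) → ℝ) (L : ℕ) (x : Fin (dims 0) → ℝ)
    (β : Fin (dims (L + 1)) → ℝ) :
    preact h dims W (Function.update b L β) L x
      = tmulVec (W L) (activ h dims W b L x) + β := by
  funext j
  simp only [preact, Function.update_self, Pi.add_apply]
  rw [activ_congr_aux h dims W W (Function.update b L β) b x L (fun _ _ => rfl)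
    (fun k hk => Function.update_of_ne (by omega) _ _)]

theorem xent_softmax {n : ℕ} [Nonempty (Fin n)] (z y : Fin n → ℝ) :
    xent (softmax z) y
      = (∑ i, y i) * Real.log (∑ j, Real.exp (z j)) - ∑ i, y i * z i := by
  have hZ : (∑ j, Real.exp (z j)) ≠ 0 :=
    (Finset.sum_pos (fun i _ => Real.exp_pos _) Finset.univ_nonempty).ne'
  simp only [xent, softmax]
  simp_rw [Real.log_div (Real.exp_ne_zero _) hZ, Real.log_exp, mul_sub,
    Finset.sum_sub_distrib, Finset.sum_mul]
  ring

theorem lse_diff {n : ℕ} [Nonempty (Fin n)] :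
    Differentiable ℝ (fun z : Fin n → ℝ => Real.log (∑ j, Real.exp (z j))) := by
  intro z
  have hZ : (∑ j, Real.exp (z j)) ≠ 0 :=
    (Finset.sum_pos (fun i _ => Real.exp_pos _) Finset.univ_nonempty).ne'
  exact DifferentiableAt.log (by fun_prop) hZ

/-- `v ↦ ∑ i, y i * v i` as a continuous linear map. -/
noncomputable def dotL {n : ℕ} (y : Fin n → ℝ) : (Fin n → ℝ) →L[ℝ] ℝ :=
  ∑ i, y i • ContinuousLinearMap.proj (R := ℝ) (φ := fun _ : Fin n => ℝ) i

theorem dotL_apply {n : ℕ} (y v : Fin n → ℝ) : dotL y v = ∑ i, y i * v i := by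
  simp [dotL]

theorem xent_hasFDerivAt {n : ℕ} [Nonempty (Fin n)] (z y : Fin n → ℝ) :
    HasFDerivAt (fun z => xent (softmax z) y)
      ((∑ i, y i) • fderiv ℝ (fun z : Fin n → ℝ => Real.log (∑ j, Real.exp (z j))) z
        - dotL y) z := by
  have h1 := ((lse_diff (n := n) z).hasFDerivAt.const_mul (∑ i, y i)).sub
    (dotL y).hasFDerivAt
  refine h1.congr_of_eventuallyEq (Filter.Eventually.of_forall fun w => ?_)
  simp [xent_softmax, dotL_apply]

/-- `V ↦ Vᵀ a` as a continuous linear map. -/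
noncomputable def tmulL {d n : ℕ} (a : Fin d → ℝ) :
    (Fin d → Fin n → ℝ) →L[ℝ] (Fin n → ℝ) :=
  LinearMap.toContinuousLinearMap
    { toFun := fun V => tmulVec V a
      map_add' := by
        intro V V'
        funext j
        simp [tmulVec, add_mul, Finset.sum_add_distrib]
      map_smul' := by
        intro c V
        funext j
        simp [tmulVec, Finset.mul_sum, mul_assoc] }

theorem tmulL_apply {d n : ℕ} (a : Fin d → ℝ) (V : Fin d → Fin n → ℝ) :
    tmulL a V = tmulVec V a := rfl

theorem tmulVec_single {d n : ℕ} (a : Fin d → ℝ) (m : Fin d) (v : Fin n → ℝ) :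
    tmulVec (Pi.single m v) a = a m • v := by
  funext j
  simp only [tmulVec, Pi.smul_apply, smul_eq_mul]
  rw [Finset.sum_eq_single m]
  · simp [mul_comm]
  · intro k _ hk
    simp [Pi.single_eq_of_ne hk]
  · simp

/-- If the last-layer weight and bias gradients of the per-example loss coincide at
`(x, y)` and `(x', y')`, the common last-layer bias gradient is nonzero, and
`∑ i, y i = ∑ i, y' i`, then `y = y'`. -/
theorem last_layer_grads_determine_label (L : ℕ) (dims : ℕ → ℕ) (h : ℝ → ℝ)
    (hdiff : Differentiable ℝ h)
    (W : ∀ i : ℕ, Fin (dims i) → Fin (dims (i + 1)) → ℝ)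
    (bias : ∀ i : ℕ, Fin (dims (i + 1)) → ℝ)
    (x x' : Fin (dims 0) → ℝ) (y y' : Fin (dims (L + 1)) → ℝ)
    (hW : fderiv ℝ (fun V : Fin (dims L) → Fin (dims (L + 1)) → ℝ =>
            xent (softmax (preact h dims (Function.update W L V) bias L x)) y) (W L)
        = fderiv ℝ (fun V : Fin (dims L) → Fin (dims (L + 1)) → ℝ =>
            xent (softmax (preact h dims (Function.update W L V) bias L x')) y') (W L))
    (hb : fderiv ℝ (fun β : Fin (dims (L + 1)) → ℝ =>
            xent (softmax (preact h dims W (Function.update bias L β) L x)) y) (bias L)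
        = fderiv ℝ (fun β : Fin (dims (L + 1)) → ℝ =>
            xent (softmax (preact h dims W (Function.update bias L β) L x')) y') (bias L))
    (hbne : fderiv ℝ (fun β : Fin (dims (L + 1)) → ℝ =>
            xent (softmax (preact h dims W (Function.update bias L β) L x)) y) (bias L) ≠ 0)
    (hsum : ∑ i, y i = ∑ i, y' i) :
    y = y' := by
  rcases isEmpty_or_nonempty (Fin (dims (L + 1))) with hE | hN
  · exact Subsingleton.elim _ _
  simp only [preact_updW] at hW
  simp only [preact_updb] at hb hbne
  generalize activ h dims W bias L x = a at *
  generalize activ h dims W bias L x' = a' at *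
  have keyb : ∀ (a : Fin (dims L) → ℝ) (y : Fin (dims (L + 1)) → ℝ), _ := fun a y =>
    ((xent_hasFDerivAt (tmulVec (W L) a + bias L) y).comp (bias L)
      ((hasFDerivAt_id (bias L)).const_add (tmulVec (W L) a))).fderiv
  have keyW : ∀ (a : Fin (dims L) → ℝ) (y : Fin (dims (L + 1)) → ℝ), _ := fun a y =>
    ((xent_hasFDerivAt (tmulVec (W L) a + bias L) y).comp (W L)
      (((tmulL a).hasFDerivAt (x := W L)).add_const (bias L))).fderiv
  have hb1 := (keyb a y).symm.trans (hb.trans (keyb a' y'))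
  have hW1 := (keyW a y).symm.trans (hW.trans (keyW a' y'))
  have hne1 := fun h0 => hbne ((keyb a y).trans h0)
  rw [ContinuousLinearMap.comp_id] at hne1
  rw [ContinuousLinearMap.comp_id, ContinuousLinearMap.comp_id] at hb1
  rw [← hb1] at hW1
  have haa : a = a' := by
    obtain ⟨v, hv⟩ := DFunLike.ne_iff.mp (show _ ≠ _ from hne1)
    funext m
    have h2 := DFunLike.congr_fun hW1 (Pi.single m v)
    rw [ContinuousLinearMap.comp_apply, ContinuousLinearMap.comp_apply, tmulL_apply,
      tmulL_apply, tmulVec_single, tmulVec_single, map_smul, map_smul] at h2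
    exact mul_right_cancel₀ hv h2
  subst haa
  rw [hsum] at hb1
  have h3 := sub_right_injective hb1
  funext i
  have h4 := DFunLike.congr_fun h3 (Pi.single i 1)
  simpa [dotL_apply, Pi.single_apply] using h4
end

section
/- (b = 1 data forging is impossible for fully connected networks.) Let f_θ be an L-layer fully connected network with differentiable activation h and n ≥ 2 output classes. Let (x, y), (x', y') ∈ ℝ^d × ℝ^n be two training examples whose labels y and y' are one-hot. If the gradients of the per-example loss with respect to every weight matrix W_i and every bias b_i (1 ≤ i ≤ L) at (x, y) equal the corresponding gradients at (x', y'), and the gradient with respect to the first-layer bias b₁ at (x, y) is nonzero, then x = x' and y = y'. -/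
open scoped BigOperators

/-- A label is one-hot if every entry is `0` or `1` and the entries sum to `1`. -/
def IsOneHot {n : ℕ} (y : Fin n → ℝ) : Prop :=
  (∀ i, y i = 0 ∨ y i = 1) ∧ ∑ i, y i = 1

theorem preact_first_aux (h : ℝ → ℝ) (dims : ℕ → ℕ) (hdiff : Differentiable ℝ h)
    (W : ∀ i : ℕ, Fin (dims i) → Fin (dims (i + 1)) → ℝ)
    (bias : ∀ i : ℕ, Fin (dims (i + 1)) → ℝ) (L : ℕ) :
    ∃ G : (Fin (dims 1) → ℝ) → Fin (dims (L + 1)) → ℝ, Differentiable ℝ G ∧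
      ∀ V β x, preact h dims (Function.update W 0 V) (Function.update bias 0 β) L x
        = G (fun j => tmulVec V x j + β j) := by
  induction L with
  | zero =>
    refine ⟨fun z => z, differentiable_id, ?_⟩
    intro V β x
    funext j
    change tmulVec (Function.update W 0 V 0) x j + Function.update bias 0 β 0 j = _
    rw [Function.update_self, Function.update_self]
  | succ L ih =>
    obtain ⟨G, hG, hGe⟩ := ih
    refine ⟨fun z j => ∑ m, W (L + 1) m j * h (G z m) + bias (L + 1) j, ?_, ?_⟩
    · have h1 : ∀ m, Differentiable ℝ (fun z => h (G z m)) := fun m =>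
        hdiff.comp (differentiable_pi.1 hG m)
      fun_prop
    · intro V β x
      funext j
      have h1 : activ h dims (Function.update W 0 V) (Function.update bias 0 β) (L + 1) x
          = fun m => h (G (fun j => tmulVec V x j + β j) m) := by
        funext m
        rw [← hGe V β x]
        rfl
      unfold preact
      rw [h1]
      simp [tmulVec]

theorem activ_last_aux (h : ℝ → ℝ) (dims : ℕ → ℕ)
    (W : ∀ i : ℕ, Fin (dims i) → Fin (dims (i + 1)) → ℝ)
    (bias : ∀ i : ℕ, Fin (dims (i + 1)) → ℝ) (L : ℕ) (β) (x) (i : ℕ) (hi : i ≤ L) :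
    activ h dims W (Function.update bias L β) i x = activ h dims W bias i x := by
  induction i with
  | zero => rfl
  | succ i ih =>
    funext j
    simp only [activ]
    rw [ih (by omega), Function.update_of_ne (by omega)]

theorem xent_softmax_aux {n : ℕ} (z y : Fin n → ℝ) (hy : IsOneHot y) :
    xent (softmax z) y = Real.log (∑ j, Real.exp (z j)) - ∑ i, y i * z i := by
  have hne : ∑ j, Real.exp (z j) ≠ 0 := by
    have : (Finset.univ : Finset (Fin n)).Nonempty := by
      by_contra hh
      have h2 := hy.2
      rw [Finset.not_nonempty_iff_eq_empty.1 hh] at h2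
      simp at h2
    exact (Finset.sum_pos (fun i _ => Real.exp_pos _) this).ne'
  unfold xent softmax
  have : ∀ i, y i * Real.log (Real.exp (z i) / ∑ j, Real.exp (z j))
      = y i * z i - y i * Real.log (∑ j, Real.exp (z j)) := by
    intro i
    rw [Real.log_div (Real.exp_pos _).ne' hne, Real.log_exp]
    ring
  simp only [this, Finset.sum_sub_distrib, ← Finset.sum_mul, hy.2]
  ring

theorem lse_diff_aux {n : ℕ} (y : Fin n → ℝ) (hy : IsOneHot y) :
    Differentiable ℝ (fun z : Fin n → ℝ => xent (softmax z) y) := by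
  have : (Finset.univ : Finset (Fin n)).Nonempty := by
    by_contra hh
    have h2 := hy.2
    rw [Finset.not_nonempty_iff_eq_empty.1 hh] at h2
    simp at h2
  have hne : ∀ z : Fin n → ℝ, ∑ j, Real.exp (z j) ≠ 0 := fun z =>
    (Finset.sum_pos (fun i _ => Real.exp_pos _) this).ne'
  simp only [xent_softmax_aux _ y hy]
  have h1 : Differentiable ℝ (fun z : Fin n → ℝ => Real.log (∑ j, Real.exp (z j))) :=
    Differentiable.log (by fun_prop) hne
  fun_prop

/-- `b = 1` data forging is impossible for fully connected networks: if the per-example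
loss gradients with respect to every weight matrix and every bias coincide at
`(x, y)` and `(x', y')`, the labels are one-hot, there are at least two classes, and
the first-layer bias gradient is nonzero, then `x = x'` and `y = y'`. -/
theorem no_single_example_forging (L : ℕ) (dims : ℕ → ℕ) (h : ℝ → ℝ)
    (hdiff : Differentiable ℝ h) (hn : 2 ≤ dims (L + 1))
    (W : ∀ i : ℕ, Fin (dims i) → Fin (dims (i + 1)) → ℝ)
    (bias : ∀ i : ℕ, Fin (dims (i + 1)) → ℝ)
    (x x' : Fin (dims 0) → ℝ) (y y' : Fin (dims (L + 1)) → ℝ)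
    (hy : IsOneHot y) (hy' : IsOneHot y')
    (hWall : ∀ i : ℕ, i ≤ L →
      fderiv ℝ (fun V : Fin (dims i) → Fin (dims (i + 1)) → ℝ =>
          xent (softmax (preact h dims (Function.update W i V) bias L x)) y) (W i)
        = fderiv ℝ (fun V : Fin (dims i) → Fin (dims (i + 1)) → ℝ =>
          xent (softmax (preact h dims (Function.update W i V) bias L x')) y') (W i))
    (hball : ∀ i : ℕ, i ≤ L →
      fderiv ℝ (fun β : Fin (dims (i + 1)) → ℝ =>
          xent (softmax (preact h dims W (Function.update bias i β) L x)) y) (bias i)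
        = fderiv ℝ (fun β : Fin (dims (i + 1)) → ℝ =>
          xent (softmax (preact h dims W (Function.update bias i β) L x')) y') (bias i))
    (hb1ne : fderiv ℝ (fun β : Fin (dims 1) → ℝ =>
          xent (softmax (preact h dims W (Function.update bias 0 β) L x)) y) (bias 0) ≠ 0) :
    x = x' ∧ y = y' := by
  obtain ⟨G, hG, hGe⟩ := preact_first_aux h dims hdiff W bias L
  have key : ∀ (y : Fin (dims (L + 1)) → ℝ), IsOneHot y → ∀ x : Fin (dims 0) → ℝ,
      ∃ D : (Fin (dims 1) → ℝ) →L[ℝ] ℝ,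
      fderiv ℝ (fun β : Fin (dims 1) → ℝ =>
          xent (softmax (preact h dims W (Function.update bias 0 β) L x)) y) (bias 0) = D ∧
      ∀ V, fderiv ℝ (fun V : Fin (dims 0) → Fin (dims 1) → ℝ =>
          xent (softmax (preact h dims (Function.update W 0 V) bias L x)) y) (W 0) V
        = D (tmulVec V x) := by
    intro y hy x
    have hF : Differentiable ℝ (fun z => xent (softmax (G z)) y) := (lse_diff_aux y hy).comp hG
    have e1 : ∀ β, preact h dims W (Function.update bias 0 β) L x
        = G (fun j => tmulVec (W 0) x j + β j) := by
      intro β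
      have := hGe (W 0) β x
      rwa [Function.update_eq_self] at this
    have e2 : ∀ V, preact h dims (Function.update W 0 V) bias L x
        = G (fun j => tmulVec V x j + bias 0 j) := by
      intro V
      have := hGe V (bias 0) x
      rwa [Function.update_eq_self] at this
    let z0 : Fin (dims 1) → ℝ := fun j => tmulVec (W 0) x j + bias 0 j
    have hD : HasFDerivAt (fun z => xent (softmax (G z)) y)
      (fderiv ℝ (fun z => xent (softmax (G z)) y) z0) z0 := (hF z0).hasFDerivAt
    refine ⟨fderiv ℝ (fun z => xent (softmax (G z)) y) z0, ?_, ?_⟩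
    · simp only [e1]
      have h1 : HasFDerivAt (fun (β : Fin (dims 1) → ℝ) => (fun j => tmulVec (W 0) x j + β j))
          (ContinuousLinearMap.id ℝ (Fin (dims 1) → ℝ)) (bias 0) :=
        (hasFDerivAt_id (bias 0)).const_add (tmulVec (W 0) x)
      have h2 := HasFDerivAt.comp (bias 0) (f := fun (β : Fin (dims 1) → ℝ) =>
        (fun j => tmulVec (W 0) x j + β j)) hD h1
      exact h2.fderiv
    · intro V
      simp only [e2]
      let T : (Fin (dims 0) → Fin (dims 1) → ℝ) →ₗ[ℝ] (Fin (dims 1) → ℝ) :=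
        { toFun := fun V => tmulVec V x
          map_add' := by
            intro a b
            funext j
            simp [tmulVec, add_mul, Finset.sum_add_distrib]
          map_smul' := by
            intro c a
            funext j
            simp [tmulVec, Finset.mul_sum, mul_assoc] }
      have h1 : HasFDerivAt (fun (V : Fin (dims 0) → Fin (dims 1) → ℝ) =>
          (fun j => tmulVec V x j + bias 0 j)) (LinearMap.toContinuousLinearMap T) (W 0) :=
        ((LinearMap.toContinuousLinearMap T).hasFDerivAt).add_const (bias 0)
      have h2 := HasFDerivAt.comp (W 0) (f := fun (V : Fin (dims 0) → Fin (dims 1) → ℝ) =>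
          (fun j => tmulVec V x j + bias 0 j)) hD h1
      have h3 := h2.fderiv
      exact congrArg (fun A => A V) h3
  have hxx : x = x' := by
    obtain ⟨D, hD1, hD2⟩ := key y hy x
    obtain ⟨D', hD1', hD2'⟩ := key y' hy' x'
    have hDD : D = D' := by
      rw [← hD1, ← hD1']
      exact hball 0 (Nat.zero_le _)
    have hD0 : D ≠ 0 := by
      rw [← hD1]
      exact hb1ne
    have hall : ∀ V, D (tmulVec V x) = D (tmulVec V x') := by
      intro V
      have h1 := hD2 V
      have h2 := hD2' V
      rw [← hDD] at h2
      rw [← h1, ← h2]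
      exact congrArg (fun A => A V) (hWall 0 (Nat.zero_le _))
    obtain ⟨v, hv⟩ : ∃ v, D v ≠ 0 := by
      by_contra hh
      push Not at hh
      exact hD0 (ContinuousLinearMap.ext hh)
    funext m
    have e : ∀ x : Fin (dims 0) → ℝ,
        tmulVec (fun k j => if k = m then v j else 0) x = x m • v := by
      intro x
      funext j
      simp [tmulVec, mul_comm]
    have h1 := hall (fun k j => if k = m then v j else 0)
    rw [e, e, map_smul, map_smul, smul_eq_mul, smul_eq_mul] at h1
    exact mul_right_cancel₀ hv h1
  refine ⟨hxx, ?_⟩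
  subst hxx
  have hL := hball L le_rfl
  have e : ∀ β, preact h dims W (Function.update bias L β) L x
      = fun j => tmulVec (W L) (activ h dims W bias L x) j + β j := by
    intro β
    unfold preact
    rw [activ_last_aux h dims W bias L β x L le_rfl]
    simp
  simp only [e] at hL
  set c := tmulVec (W L) (activ h dims W bias L x) with hc
  have hsh : Differentiable ℝ (fun β : Fin (dims (L + 1)) → ℝ => fun j => c j + β j) := by
    fun_prop
  have d1 : Differentiable ℝ (fun β : Fin (dims (L + 1)) → ℝ =>
      xent (softmax fun j => c j + β j) y) := (lse_diff_aux y hy).comp hsh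
  have d2 : Differentiable ℝ (fun β : Fin (dims (L + 1)) → ℝ =>
      xent (softmax fun j => c j + β j) y') := (lse_diff_aux y' hy').comp hsh
  have h0 : HasFDerivAt (fun β : Fin (dims (L + 1)) → ℝ =>
      xent (softmax fun j => c j + β j) y' - xent (softmax fun j => c j + β j) y)
      (0 : (Fin (dims (L + 1)) → ℝ) →L[ℝ] ℝ) (bias L) := by
    have := (d2 (bias L)).hasFDerivAt.sub (d1 (bias L)).hasFDerivAt
    rw [hL, sub_self] at this
    exact this
  let S : (Fin (dims (L + 1)) → ℝ) →L[ℝ] ℝ :=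
    ∑ i, (y i - y' i) • ContinuousLinearMap.proj (R := ℝ) (φ := fun _ => ℝ) i
  have hS : ∀ v, S v = ∑ i, (y i - y' i) * v i := by
    intro v
    simp [S]
  have h1 : (fun β : Fin (dims (L + 1)) → ℝ =>
      xent (softmax fun j => c j + β j) y' - xent (softmax fun j => c j + β j) y)
      = fun β => S β + S c := by
    funext β
    rw [xent_softmax_aux _ _ hy, xent_softmax_aux _ _ hy', hS, hS, sub_sub_sub_cancel_left,
      ← Finset.sum_sub_distrib, ← Finset.sum_add_distrib]
    exact Finset.sum_congr rfl fun i _ => by ring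
  rw [h1] at h0
  have h2 : S = 0 := (S.hasFDerivAt.add_const (S c)).unique h0
  funext i
  have h3 := hS (Pi.single i 1)
  rw [h2] at h3
  simp [Pi.single_apply] at h3
  linarith
end
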